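/- Suppose λ₁* = λ₂* = ⋯ = λ_r*, η ≤ 1/(12·λ₁*), X_t ∈ R₂, and σ_r(U_t)² ≤ 1/(8η). Then σ_r(U_{t+1})² ≥ (1 + 2η·λ_r* − 2η·σ₁(J_t)² − 2η·σ_r(U_t)²)·σ_r(U_t)², and in particular σ_r(U_{t+1})² ≥ (1 + ηΔ − 2η·σ_r(U_t)²)·σ_r(U_t)². -/

import Mathlib

open Matrix

/-- The largest singular value of a real matrix. -/
noncomputable def sigmaMax {m n : ℕ} (M : Matrix (Fin m) (Fin n) ℝ) : ℝ :=
  sSup {c : ℝ | ∃ v : EuclideanSpace ℝ (Fin n), ‖v‖ = 1 ∧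
    c = ‖(EuclideanSpace.equiv (Fin m) ℝ).symm (M.mulVec ((EuclideanSpace.equiv (Fin n) ℝ) v))‖}

/-- The smallest singular value (the `n`-th largest, for a matrix with `n` columns). -/
noncomputable def sigmaMin {m n : ℕ} (M : Matrix (Fin m) (Fin n) ℝ) : ℝ :=
  sInf {c : ℝ | ∃ v : EuclideanSpace ℝ (Fin n), ‖v‖ = 1 ∧
    c = ‖(EuclideanSpace.equiv (Fin m) ℝ).symm (M.mulVec ((EuclideanSpace.equiv (Fin n) ℝ) v))‖}

/-- Frobenius norm of a real matrix. -/
noncomputable def frobNorm {m n : ℕ} (M : Matrix (Fin m) (Fin n) ℝ) : ℝ :=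
  Real.sqrt (∑ i, ∑ j, (M i j) ^ 2)

/-- Gradient descent iterates `X_{t+1} = X_t + η (Σ - X_t X_tᵀ) X_t`. -/
noncomputable def gdIter {d r : ℕ} (S : Matrix (Fin d) (Fin d) ℝ) (η : ℝ)
    (X0 : Matrix (Fin d) (Fin r) ℝ) : ℕ → Matrix (Fin d) (Fin r) ℝ
  | 0 => X0
  | t + 1 => gdIter S η X0 t +
      η • ((S - gdIter S η X0 t * (gdIter S η X0 t)ᵀ) * gdIter S η X0 t)

/-- The top `r × r` block `U` (first `r` rows) of `X ∈ ℝ^{d×r}`. -/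
def topBlock {d r : ℕ} (h : r ≤ d) (X : Matrix (Fin d) (Fin r) ℝ) :
    Matrix (Fin r) (Fin r) ℝ :=
  fun i j => X (Fin.castLE h i) j

/-- The bottom `(d-r) × r` block `J` (last `d-r` rows) of `X ∈ ℝ^{d×r}`. -/
def botBlock {d r : ℕ} (X : Matrix (Fin d) (Fin r) ℝ) :
    Matrix (Fin (d - r)) (Fin r) ℝ :=
  fun i j => X ⟨r + (i : ℕ), by have := i.isLt; omega⟩ j

/-- The region `R = {X : σ₁(X)² ≤ 2λ₁*, σ₁(J)² ≤ λ_r* − Δ/2, σ_r(U)² ≥ Δ/4}`. -/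
def inR {d r : ℕ} (h : r ≤ d) (lam1 lamr Δ : ℝ) (X : Matrix (Fin d) (Fin r) ℝ) : Prop :=
  sigmaMax X ^ 2 ≤ 2 * lam1 ∧ sigmaMax (botBlock X) ^ 2 ≤ lamr - Δ / 2 ∧
    Δ / 4 ≤ sigmaMin (topBlock h X) ^ 2

/-- The region `R₂ = {X : σ₁(X)² ≤ 2λ₁*, σ₁(J)² ≤ λ_r* − Δ/2}`. -/
def inR2 {d r : ℕ} (lam1 lamr Δ : ℝ) (X : Matrix (Fin d) (Fin r) ℝ) : Prop :=
  sigmaMax X ^ 2 ≤ 2 * lam1 ∧ sigmaMax (botBlock X) ^ 2 ≤ lamr - Δ / 2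

theorem euclideanNorm_sq_eq_dotProduct {n : ℕ} (v : Fin n → ℝ) :
    ‖(EuclideanSpace.equiv (Fin n) ℝ).symm v‖ ^ 2 = v ⬝ᵥ v := by
  rw [EuclideanSpace.norm_sq_eq]
  simp [dotProduct, sq]

theorem real_dotProduct_self_nonneg {n : ℕ} (v : Fin n → ℝ) : 0 ≤ v ⬝ᵥ v :=
  Finset.sum_nonneg fun i _ => mul_self_nonneg (v i)

theorem bddBelow_norm_mulVec {m n : ℕ} (M : Matrix (Fin m) (Fin n) ℝ) :
    BddBelow {c : ℝ | ∃ v : EuclideanSpace ℝ (Fin n), ‖v‖ = 1 ∧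
      c = ‖(EuclideanSpace.equiv (Fin m) ℝ).symm
        (M.mulVec ((EuclideanSpace.equiv (Fin n) ℝ) v))‖} :=
  ⟨0, by rintro _ ⟨v, _, rfl⟩; exact norm_nonneg _⟩

theorem bddAbove_norm_mulVec {m n : ℕ} (M : Matrix (Fin m) (Fin n) ℝ) :
    BddAbove {c : ℝ | ∃ v : EuclideanSpace ℝ (Fin n), ‖v‖ = 1 ∧
      c = ‖(EuclideanSpace.equiv (Fin m) ℝ).symm
        (M.mulVec ((EuclideanSpace.equiv (Fin n) ℝ) v))‖} := by
  refine ⟨‖LinearMap.toContinuousLinearMap (Matrix.toEuclideanLin M)‖, ?_⟩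
  rintro _ ⟨v, hv, rfl⟩
  have h := (LinearMap.toContinuousLinearMap (Matrix.toEuclideanLin M)).le_opNorm v
  rwa [hv, mul_one] at h

theorem sigmaMin_nonneg {m n : ℕ} (M : Matrix (Fin m) (Fin n) ℝ) : 0 ≤ sigmaMin M :=
  Real.sInf_nonneg (by rintro _ ⟨v, _, rfl⟩; exact norm_nonneg _)

/-- A nonzero vector scales to a unit vector, and its image under `M` scales along. -/
theorem exists_unit_norm_mulVec {m n : ℕ} (M : Matrix (Fin m) (Fin n) ℝ) {v : Fin n → ℝ}
    (hv : v ≠ 0) :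
    ∃ u : EuclideanSpace ℝ (Fin n), ‖u‖ = 1 ∧
      M *ᵥ v ⬝ᵥ M *ᵥ v = ‖(EuclideanSpace.equiv (Fin m) ℝ).symm
        (M.mulVec ((EuclideanSpace.equiv (Fin n) ℝ) u))‖ ^ 2 * (v ⬝ᵥ v) := by
  set x := (EuclideanSpace.equiv (Fin n) ℝ).symm v with hx
  have hx0 : ‖x‖ ≠ 0 := by simpa [hx] using hv
  refine ⟨‖x‖⁻¹ • x, ?_, ?_⟩
  · rw [norm_smul, norm_inv, norm_norm, inv_mul_cancel₀ hx0]
  · rw [euclideanNorm_sq_eq_dotProduct, ← euclideanNorm_sq_eq_dotProduct v, map_smul, hx,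
      ContinuousLinearEquiv.apply_symm_apply, ← hx, mulVec_smul, smul_dotProduct,
      dotProduct_smul, smul_eq_mul, smul_eq_mul]
    field_simp

theorem sigmaMin_sq_mul_le {m n : ℕ} (M : Matrix (Fin m) (Fin n) ℝ) (v : Fin n → ℝ) :
    sigmaMin M ^ 2 * (v ⬝ᵥ v) ≤ M *ᵥ v ⬝ᵥ M *ᵥ v := by
  by_cases hv : v = 0
  · simp [hv]
  obtain ⟨u, hu, h⟩ := exists_unit_norm_mulVec M hv
  rw [h]
  have hle := csInf_le (bddBelow_norm_mulVec M) ⟨u, hu, rfl⟩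
  exact mul_le_mul_of_nonneg_right (pow_le_pow_left₀ (sigmaMin_nonneg M) hle 2)
    (real_dotProduct_self_nonneg v)

theorem le_sigmaMax_sq_mul {m n : ℕ} (M : Matrix (Fin m) (Fin n) ℝ) (v : Fin n → ℝ) :
    M *ᵥ v ⬝ᵥ M *ᵥ v ≤ sigmaMax M ^ 2 * (v ⬝ᵥ v) := by
  by_cases hv : v = 0
  · simp [hv]
  obtain ⟨u, hu, h⟩ := exists_unit_norm_mulVec M hv
  rw [h]
  have hle := le_csSup (bddAbove_norm_mulVec M) ⟨u, hu, rfl⟩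
  exact mul_le_mul_of_nonneg_right (pow_le_pow_left₀ (norm_nonneg _) hle 2)
    (real_dotProduct_self_nonneg v)

theorem le_sigmaMin_sq {m n : ℕ} (hn : 0 < n) (M : Matrix (Fin m) (Fin n) ℝ) {c : ℝ}
    (h : ∀ v, c * (v ⬝ᵥ v) ≤ M *ᵥ v ⬝ᵥ M *ᵥ v) : c ≤ sigmaMin M ^ 2 := by
  refine (Real.sqrt_le_left (sigmaMin_nonneg M)).1 (le_csInf ?_ ?_)
  · exact ⟨_, EuclideanSpace.single ⟨0, hn⟩ 1, by simp, rfl⟩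
  · rintro _ ⟨v, hv, rfl⟩
    refine Real.sqrt_le_iff.2 ⟨norm_nonneg _, ?_⟩
    have hvv : (EuclideanSpace.equiv (Fin n) ℝ v) ⬝ᵥ (EuclideanSpace.equiv (Fin n) ℝ v) = 1 := by
      rw [← euclideanNorm_sq_eq_dotProduct, ContinuousLinearEquiv.symm_apply_apply, hv, one_pow]
    rw [euclideanNorm_sq_eq_dotProduct]
    simpa [hvv] using h (EuclideanSpace.equiv (Fin n) ℝ v)

theorem dotProduct_sq_le {n : ℕ} (v w : Fin n → ℝ) :
    (v ⬝ᵥ w) ^ 2 ≤ (v ⬝ᵥ v) * (w ⬝ᵥ w) := by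
  simpa [dotProduct, sq] using Finset.sum_mul_sq_le_sq_mul_sq Finset.univ v w

theorem mulVec_transpose_dotProduct {m n : ℕ} (A : Matrix (Fin m) (Fin n) ℝ)
    (w : Fin m → ℝ) (v : Fin n → ℝ) : Aᵀ *ᵥ w ⬝ᵥ v = w ⬝ᵥ A *ᵥ v := by
  rw [mulVec_transpose, dotProduct_mulVec]

/-- A lower bound on the singular values of a square matrix passes to its transpose. -/
theorem transpose_mulVec_lower_bound {n : ℕ} (A : Matrix (Fin n) (Fin n) ℝ) {c : ℝ}
    (h : ∀ v, c * (v ⬝ᵥ v) ≤ A *ᵥ v ⬝ᵥ A *ᵥ v) (w : Fin n → ℝ) :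
    c * (w ⬝ᵥ w) ≤ Aᵀ *ᵥ w ⬝ᵥ Aᵀ *ᵥ w := by
  have hw := real_dotProduct_self_nonneg w
  have hAw := real_dotProduct_self_nonneg (Aᵀ *ᵥ w)
  rcases le_or_gt c 0 with hc | hc
  · exact (mul_nonpos_of_nonpos_of_nonneg hc hw).trans hAw
  have hinj : Function.Injective A.mulVecLin := by
    rw [← LinearMap.ker_eq_bot, LinearMap.ker_eq_bot']
    intro v hv
    have hv' : A *ᵥ v = 0 := hv
    have := h v
    rw [hv', dotProduct_zero] at this
    exact dotProduct_self_eq_zero.1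
      (le_antisymm (nonpos_of_mul_nonpos_right this hc) (real_dotProduct_self_nonneg v))
  obtain ⟨v, hv⟩ := LinearMap.injective_iff_surjective.1 hinj w
  have hv' : A *ᵥ v = w := hv
  have h1 := h v
  have h2 := dotProduct_sq_le (Aᵀ *ᵥ w) v
  rw [mulVec_transpose_dotProduct, hv'] at h2
  rw [hv'] at h1
  rcases hw.eq_or_lt with h0 | h0
  · rw [← h0, mul_zero]; exact hAw
  · refine le_of_mul_le_mul_right ?_ h0
    nlinarith [mul_le_mul_of_nonneg_left h1 hAw]

theorem transpose_mulVec_upper_bound {m n : ℕ} (A : Matrix (Fin m) (Fin n) ℝ) {L : ℝ}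
    (h : ∀ v, A *ᵥ v ⬝ᵥ A *ᵥ v ≤ L * (v ⬝ᵥ v)) (w : Fin m → ℝ) (hL : 0 ≤ L) :
    Aᵀ *ᵥ w ⬝ᵥ Aᵀ *ᵥ w ≤ L * (w ⬝ᵥ w) := by
  have hw := real_dotProduct_self_nonneg w
  have hAw := real_dotProduct_self_nonneg (Aᵀ *ᵥ w)
  have h2 := dotProduct_sq_le w (A *ᵥ Aᵀ *ᵥ w)
  rw [← mulVec_transpose_dotProduct] at h2
  rcases hAw.eq_or_lt with h0 | h0
  · rw [← h0]; positivity
  · refine le_of_mul_le_mul_right ?_ h0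
    nlinarith [mul_le_mul_of_nonneg_left (h (Aᵀ *ᵥ w)) hw]

/-- If `s ≤ A Aᵀ ≤ L` then `(a - 2 η s) s ≤ a A Aᵀ - 2 η (A Aᵀ)²`, provided
`x ↦ a x - 2 η x²` has slope at least `2 η L` at `s`. -/
theorem quadratic_gram_lower_bound {m n : ℕ} (A : Matrix (Fin m) (Fin n) ℝ) {s L a η : ℝ}
    (hs : 0 ≤ s) (hL : 0 < L) (hη : 0 ≤ η) (ha : 2 * η * L ≤ a - 4 * η * s)
    (hlow : ∀ w, s * (w ⬝ᵥ w) ≤ Aᵀ *ᵥ w ⬝ᵥ Aᵀ *ᵥ w)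
    (hupp : ∀ w, Aᵀ *ᵥ w ⬝ᵥ Aᵀ *ᵥ w ≤ L * (w ⬝ᵥ w)) (w : Fin m → ℝ) :
    (a - 2 * η * s) * s * (w ⬝ᵥ w) ≤
      a * (Aᵀ *ᵥ w ⬝ᵥ Aᵀ *ᵥ w) -
        2 * η * (A *ᵥ Aᵀ *ᵥ w ⬝ᵥ A *ᵥ Aᵀ *ᵥ w) := by
  set y := Aᵀ *ᵥ w with hy
  set x := A *ᵥ y with hx
  have hwx : w ⬝ᵥ x = y ⬝ᵥ y := by rw [hx, hy, mulVec_transpose_dotProduct]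
  set g := x - s • w with hg
  have hgg : g ⬝ᵥ g = x ⬝ᵥ x - 2 * s * (y ⬝ᵥ y) + s ^ 2 * (w ⬝ᵥ w) := by
    simp only [hg, sub_dotProduct, dotProduct_sub, smul_dotProduct, dotProduct_smul, smul_eq_mul,
      dotProduct_comm x w, hwx]
    ring
  have hyg : y ⬝ᵥ Aᵀ *ᵥ g - s * (w ⬝ᵥ g) = g ⬝ᵥ g := by
    rw [dotProduct_comm y, mulVec_transpose_dotProduct, ← hx, ← smul_eq_mul, ← smul_dotProduct,
      dotProduct_comm g x, ← sub_dotProduct]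
  have hz := hlow (w - L⁻¹ • g)
  have hgu := hupp g
  have hg0 := real_dotProduct_self_nonneg g
  simp only [mulVec_sub, mulVec_smul, ← hy, sub_dotProduct, dotProduct_sub, smul_dotProduct,
    dotProduct_smul, smul_eq_mul, dotProduct_comm g w, dotProduct_comm (Aᵀ *ᵥ g) y] at hz
  have hp : g ⬝ᵥ g ≤ L * (y ⬝ᵥ y - s * (w ⬝ᵥ w)) := by
    have hLi : L⁻¹ * L = 1 := inv_mul_cancel₀ hL.ne'
    have hLp : 0 < L⁻¹ := inv_pos.2 hL
    have h1 : L⁻¹ * (L⁻¹ * (Aᵀ *ᵥ g ⬝ᵥ Aᵀ *ᵥ g)) ≤ L⁻¹ * (g ⬝ᵥ g) := by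
      refine mul_le_mul_of_nonneg_left ?_ hLp.le
      calc L⁻¹ * (Aᵀ *ᵥ g ⬝ᵥ Aᵀ *ᵥ g) ≤ L⁻¹ * (L * (g ⬝ᵥ g)) :=
            mul_le_mul_of_nonneg_left hgu hLp.le
        _ = g ⬝ᵥ g := by rw [← mul_assoc, hLi, one_mul]
    have h2 : 0 ≤ s * (L⁻¹ * (L⁻¹ * (g ⬝ᵥ g))) := by positivity
    have h3 : L⁻¹ * (g ⬝ᵥ g) ≤ y ⬝ᵥ y - s * (w ⬝ᵥ w) := by
      linear_combination hz + h1 + h2 - 2 * L⁻¹ * hyg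
    rwa [inv_mul_le_iff₀ hL] at h3
  have hp0 : 0 ≤ y ⬝ᵥ y - s * (w ⬝ᵥ w) := sub_nonneg.2 (hlow w)
  have h4 := mul_le_mul_of_nonneg_right ha hp0
  have h5 := mul_le_mul_of_nonneg_left hp (mul_nonneg zero_le_two hη)
  rw [hgg] at h5
  linear_combination h4 + h5

theorem sum_fin_eq_sum_castLE_add {r k d : ℕ} (h : r + k = d) (f : Fin d → ℝ) :
    ∑ i, f i = ∑ i : Fin r, f (Fin.castLE (by omega) i) +
      ∑ i : Fin k, f ⟨r + (i : ℕ), by have := i.isLt; omega⟩ := by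
  subst h
  exact Fin.sum_univ_add f

theorem mulVec_dotProduct_eq_topBlock_add_botBlock {d r : ℕ} (h : r ≤ d)
    (X : Matrix (Fin d) (Fin r) ℝ) (v : Fin r → ℝ) :
    X *ᵥ v ⬝ᵥ X *ᵥ v = topBlock h X *ᵥ v ⬝ᵥ topBlock h X *ᵥ v +
      botBlock X *ᵥ v ⬝ᵥ botBlock X *ᵥ v :=
  sum_fin_eq_sum_castLE_add (Nat.add_sub_cancel' h) fun i => (X *ᵥ v) i * (X *ᵥ v) i

/-- One gradient step on the top block when the top `r` eigenvalues all equal `μ`. -/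
theorem topBlock_gradient_step {d r : ℕ} (h : r ≤ d) (lam : Fin d → ℝ) {μ : ℝ}
    (hμ : ∀ i : Fin r, lam (Fin.castLE h i) = μ) (η : ℝ) (X : Matrix (Fin d) (Fin r) ℝ) :
    topBlock h (X + η • ((diagonal lam - X * Xᵀ) * X)) =
      topBlock h X + η • (μ • topBlock h X - topBlock h X * (Xᵀ * X)) := by
  have hmul : topBlock h X * (Xᵀ * X) = topBlock h (X * (Xᵀ * X)) := rfl
  rw [hmul, Matrix.sub_mul, Matrix.mul_assoc]
  ext i j
  simp [topBlock, diagonal_mul, hμ]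

theorem sigmaMin_topBlock_gradient_step {d r : ℕ} (hr : 0 < r) (h : r ≤ d) (lam : Fin d → ℝ)
    {μ : ℝ} (hμ0 : 0 < μ) (hμ : ∀ i : Fin r, lam (Fin.castLE h i) = μ) {η : ℝ} (hη : 0 < η)
    (hημ : η * μ ≤ 1 / 12) (X : Matrix (Fin d) (Fin r) ℝ) (hX : sigmaMax X ^ 2 ≤ 2 * μ)
    (hJ : sigmaMax (botBlock X) ^ 2 ≤ μ) (hU : η * sigmaMin (topBlock h X) ^ 2 ≤ 1 / 8) :
    (1 + 2 * η * μ - 2 * η * sigmaMax (botBlock X) ^ 2 -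
        2 * η * sigmaMin (topBlock h X) ^ 2) * sigmaMin (topBlock h X) ^ 2 ≤
      sigmaMin (topBlock h (X + η • ((diagonal lam - X * Xᵀ) * X))) ^ 2 := by
  set U := topBlock h X with hUdef
  set J := botBlock X with hJdef
  refine le_sigmaMin_sq hr _ fun v => ?_
  rw [← transpose_transpose (topBlock h (X + _))]
  refine transpose_mulVec_lower_bound _ (fun w => ?_) v
  have hupp : ∀ v, U *ᵥ v ⬝ᵥ U *ᵥ v ≤ 2 * μ * (v ⬝ᵥ v) := fun v => by
    have h1 := mulVec_dotProduct_eq_topBlock_add_botBlock h X v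
    have h2 := real_dotProduct_self_nonneg (J *ᵥ v)
    have h3 := le_sigmaMax_sq_mul X v
    have h4 := mul_le_mul_of_nonneg_right hX (real_dotProduct_self_nonneg v)
    linarith
  have key := quadratic_gram_lower_bound U (s := sigmaMin U ^ 2) (L := 2 * μ)
    (a := 1 + 2 * η * μ - 2 * η * sigmaMax J ^ 2) (η := η) (sq_nonneg _) (by positivity) hη.le
    (by nlinarith [mul_le_mul_of_nonneg_left hJ hη.le])
    (transpose_mulVec_lower_bound U (sigmaMin_sq_mul_le U))
    (fun w => transpose_mulVec_upper_bound U hupp w (by positivity)) w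
  refine key.trans ?_
  have hstep : (topBlock h (X + η • ((diagonal lam - X * Xᵀ) * X)))ᵀ *ᵥ w =
      Uᵀ *ᵥ w + η • (μ • (Uᵀ *ᵥ w) - Xᵀ *ᵥ X *ᵥ Uᵀ *ᵥ w) := by
    rw [topBlock_gradient_step h lam hμ, ← hUdef]
    simp only [transpose_add, transpose_smul, transpose_sub, transpose_mul, transpose_transpose,
      add_mulVec, smul_mulVec, sub_mulVec, mulVec_mulVec, Matrix.mul_assoc]
  rw [hstep]
  set y := Uᵀ *ᵥ w
  set b := μ • y - Xᵀ *ᵥ X *ᵥ y with hb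
  have hyb : y ⬝ᵥ b = μ * (y ⬝ᵥ y) - (U *ᵥ y ⬝ᵥ U *ᵥ y + J *ᵥ y ⬝ᵥ J *ᵥ y) := by
    rw [← mulVec_dotProduct_eq_topBlock_add_botBlock h X y, hb, dotProduct_sub, dotProduct_smul,
      smul_eq_mul, dotProduct_comm y (Xᵀ *ᵥ _), mulVec_transpose_dotProduct X]
  have hexp : (y + η • b) ⬝ᵥ (y + η • b) = y ⬝ᵥ y + 2 * η * (y ⬝ᵥ b) + η ^ 2 * (b ⬝ᵥ b) := by
    simp only [add_dotProduct, dotProduct_add, smul_dotProduct, dotProduct_smul, smul_eq_mul,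
      dotProduct_comm b y]
    ring
  have hb0 : 0 ≤ η ^ 2 * (b ⬝ᵥ b) := mul_nonneg (sq_nonneg _) (real_dotProduct_self_nonneg b)
  have hJy := mul_le_mul_of_nonneg_left (le_sigmaMax_sq_mul J y) (mul_nonneg zero_le_two hη.le)
  rw [hexp, hyb]
  linear_combination hb0 + hJy

/-- One-step growth of the signal `σ_r(U_t)²` when the top `r` eigenvalues are equal. -/
theorem signal_growth_equal_eigenvalues (d r : ℕ) (hr : 0 < r) (hrd : r < d)
    (lam : Fin d → ℝ)
    (hmono : ∀ i j : Fin d, i ≤ j → lam j ≤ lam i)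
    (hnn : ∀ i, 0 ≤ lam i)
    (hlam1 : 0 < lam ⟨0, by omega⟩)
    (htop : ∀ i : Fin d, (i : ℕ) < r → lam i = lam ⟨0, by omega⟩)
    (η : ℝ) (hη : 0 < η)
    (hηle : η ≤ 1 / (12 * lam ⟨0, by omega⟩))
    (X0 : Matrix (Fin d) (Fin r) ℝ) (t : ℕ)
    (hXt : inR2 (lam ⟨0, by omega⟩) (lam ⟨r - 1, by omega⟩)
      (lam ⟨r - 1, by omega⟩ - lam ⟨r, hrd⟩) (gdIter (Matrix.diagonal lam) η X0 t))
    (hUt : sigmaMin (topBlock hrd.le (gdIter (Matrix.diagonal lam) η X0 t)) ^ 2 ≤ 1 / (8 * η)) :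
    ((1 + 2 * η * lam ⟨r - 1, by omega⟩ -
        2 * η * sigmaMax (botBlock (gdIter (Matrix.diagonal lam) η X0 t)) ^ 2 -
        2 * η * sigmaMin (topBlock hrd.le (gdIter (Matrix.diagonal lam) η X0 t)) ^ 2) *
      sigmaMin (topBlock hrd.le (gdIter (Matrix.diagonal lam) η X0 t)) ^ 2 ≤
      sigmaMin (topBlock hrd.le (gdIter (Matrix.diagonal lam) η X0 (t + 1))) ^ 2) ∧
    ((1 + η * (lam ⟨r - 1, by omega⟩ - lam ⟨r, hrd⟩) -
        2 * η * sigmaMin (topBlock hrd.le (gdIter (Matrix.diagonal lam) η X0 t)) ^ 2) *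
      sigmaMin (topBlock hrd.le (gdIter (Matrix.diagonal lam) η X0 t)) ^ 2 ≤
      sigmaMin (topBlock hrd.le (gdIter (Matrix.diagonal lam) η X0 (t + 1))) ^ 2) := by
  have hlr : lam ⟨r - 1, by omega⟩ = lam ⟨0, by omega⟩ := htop _ (by simp; omega)
  obtain ⟨hX, hJ⟩ := hXt
  set X := gdIter (Matrix.diagonal lam) η X0 t
  have hΔ : lam ⟨r, hrd⟩ ≤ lam ⟨r - 1, by omega⟩ := hmono _ _ (by simp)
  have hmain := sigmaMin_topBlock_gradient_step hr hrd.le lam hlam1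
    (fun i => htop _ (by simp)) hη
    (by rw [le_div_iff₀ (by positivity)] at hηle; linarith) X hX (by linarith)
    (by rw [le_div_iff₀ (by positivity)] at hUt; linarith)
  rw [← hlr] at hmain
  refine ⟨hmain, le_trans (mul_le_mul_of_nonneg_right ?_ (sq_nonneg _)) hmain⟩
  linear_combination 2 * η * hJ
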